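/- arXiv:2512.08775 — 2 statements merged into one kernel-verified Lean document; each statement's English description precedes it below -/
import Mathlib

section
/- Let f : ℝⁿ → ℝ be twice continuously differentiable with L₂-Lipschitz Hessian, and let ρ : ℝⁿ → ℝ be twice continuously differentiable, σ_V-strongly convex, with L_V-Lipschitz gradient, where 2σ_V > L_V. Fix η > 0, ξ ∈ (0, 1), a point x_k with ∇f(x_k) ≠ 0, and a symmetric matrix H_k. Define r_k = ξ / ( (‖∇²f(x_k) − H_k‖/‖∇f(x_k)‖^{1/2})·(1 + L_V/(2σ_V − L_V)) + √(ξ·(L₂/2 + L_V·(2η + L₂/3)/(2σ_V − L_V))) ) and A_k = ‖∇²f(x_k) − H_k‖/(2σ_V − L_V) + (r_k‖∇f(x_k)‖^{1/2}/(2σ_V − L_V))·(2η + L₂/3). Suppose d ∈ ℝⁿ and λ ≥ 0 satisfy: (i) H_k d + λd + A_k(∇ρ(x_k + d) − ∇ρ(x_k)) = −∇f(x_k); (ii) H_k + A_k∇²ρ(x_k + d) + λI is positive semidefinite; (iii) ‖d‖ ≤ r_k‖∇f(x_k)‖^{1/2}; (iv) λ·(‖d‖ − r_k‖∇f(x_k)‖^{1/2})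 = 0. Then either f(x_k + d) − f(x_k) ≤ −η r_k³‖∇f(x_k)‖^{3/2}, or ‖∇f(x_k + d)‖ ≤ ξ‖∇f(x_k)‖. -/
open RealInnerProductSpace

section Taylor

variable {E : Type*} [NormedAddCommGroup E] [InnerProductSpace ℝ E]

theorem hasDerivAt_add_smul (x d : E) (t : ℝ) : HasDerivAt (fun s : ℝ => x + s • d) d t := by
  simpa using ((hasDerivAt_id t).smul_const d).const_add x

/-- First-order Taylor bound for a map whose derivative is `L`-Lipschitz. -/
theorem norm_sub_sub_fderiv_le {F : E → E} {L : ℝ} (hF : Differentiable ℝ F)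
    (hL : ∀ x y, ‖fderiv ℝ F x - fderiv ℝ F y‖ ≤ L * ‖x - y‖) (x d : E) :
    ‖F (x + d) - F x - fderiv ℝ F x d‖ ≤ L / 2 * ‖d‖ ^ 2 := by
  have hderiv (t : ℝ) : HasDerivAt (fun s : ℝ => F (x + s • d) - F x - s • fderiv ℝ F x d)
      (fderiv ℝ F (x + t • d) d - fderiv ℝ F x d) t := by
    have h := ((hF (x + t • d)).hasFDerivAt.comp_hasDerivAt t
      (hasDerivAt_add_smul x d t)).sub_const (F x)
    exact (h.sub ((hasDerivAt_id t).smul_const (fderiv ℝ F x d))).congr_deriv (by simp)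
  have hB (t : ℝ) : HasDerivAt (fun s : ℝ => L / 2 * ‖d‖ ^ 2 * s ^ 2) (L * t * ‖d‖ ^ 2) t := by
    refine ((hasDerivAt_pow 2 t).const_mul (L / 2 * ‖d‖ ^ 2)).congr_deriv ?_
    push_cast
    ring
  have h := image_norm_le_of_norm_deriv_right_le_deriv_boundary (a := 0) (b := 1)
    (fun t _ => (hderiv t).continuousAt.continuousWithinAt)
    (fun t _ => (hderiv t).hasDerivWithinAt) (by simp) hB
    (fun t ht => by
      calc ‖fderiv ℝ F (x + t • d) d - fderiv ℝ F x d‖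
          = ‖(fderiv ℝ F (x + t • d) - fderiv ℝ F x) d‖ := rfl
        _ ≤ ‖fderiv ℝ F (x + t • d) - fderiv ℝ F x‖ * ‖d‖ := ContinuousLinearMap.le_opNorm _ _
        _ ≤ L * ‖x + t • d - x‖ * ‖d‖ := by gcongr; exact hL _ _
        _ = L * t * ‖d‖ ^ 2 := by
          rw [add_sub_cancel_left, norm_smul, Real.norm_of_nonneg ht.1]
          ring)
    (Set.right_mem_Icc.2 zero_le_one)
  simpa using h

theorem inner_fderiv_le_of_lipschitz {F : E → E} {L : ℝ} (hL0 : 0 ≤ L)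
    (hL : ∀ x y, ‖F y - F x‖ ≤ L * ‖y - x‖) (x d : E) :
    ⟪fderiv ℝ F x d, d⟫ ≤ L * ‖d‖ ^ 2 := by
  have h : ‖fderiv ℝ F x‖ ≤ L :=
    norm_fderiv_le_of_lip' ℝ hL0 (Filter.Eventually.of_forall fun y => hL x y)
  calc ⟪fderiv ℝ F x d, d⟫ ≤ ‖fderiv ℝ F x d‖ * ‖d‖ := real_inner_le_norm _ _
    _ ≤ L * ‖d‖ * ‖d‖ := by gcongr; exact ContinuousLinearMap.le_of_opNorm_le _ h d
    _ = L * ‖d‖ ^ 2 := by ring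

variable [CompleteSpace E]

theorem contDiff_one_gradient {f : E → ℝ} (hf : ContDiff ℝ 2 f) : ContDiff ℝ 1 (gradient f) :=
  (InnerProductSpace.toDual ℝ E).symm.contDiff.comp
    (hf.fderiv_right (m := 1) (by norm_num))

theorem differentiable_gradient {f : E → ℝ} (hf : ContDiff ℝ 2 f) :
    Differentiable ℝ (gradient f) :=
  (contDiff_one_gradient hf).differentiable (by norm_num)

/-- Second-order Taylor bound for a function with `L`-Lipschitz Hessian. -/
theorem abs_sub_quadratic_model_le {f : E → ℝ} {L : ℝ} (hf : ContDiff ℝ 2 f)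
    (hL : ∀ x y, ‖fderiv ℝ (gradient f) x - fderiv ℝ (gradient f) y‖ ≤ L * ‖x - y‖) (x d : E) :
    |f (x + d) - f x - ⟪gradient f x, d⟫ - 1 / 2 * ⟪fderiv ℝ (gradient f) x d, d⟫|
      ≤ L / 6 * ‖d‖ ^ 3 := by
  have hderiv (t : ℝ) : HasDerivAt (fun s : ℝ => f (x + s • d) - f x - s * ⟪gradient f x, d⟫
        - s ^ 2 * (1 / 2 * ⟪fderiv ℝ (gradient f) x d, d⟫))
      ⟪gradient f (x + t • d) - gradient f x - fderiv ℝ (gradient f) x (t • d), d⟫ t := by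
    have hfd : DifferentiableAt ℝ f (x + t • d) := hf.differentiable (by norm_num) _
    have h := ((hfd.hasGradientAt.hasFDerivAt.comp_hasDerivAt t
      (hasDerivAt_add_smul x d t)).sub_const (f x)).sub
        ((hasDerivAt_id t).mul_const ⟪gradient f x, d⟫)
    refine (h.sub ((hasDerivAt_pow 2 t).mul_const
      (1 / 2 * ⟪fderiv ℝ (gradient f) x d, d⟫))).congr_deriv ?_
    simp [inner_sub_left, inner_smul_left]
    ring
  have hB (t : ℝ) : HasDerivAt (fun s : ℝ => L / 6 * ‖d‖ ^ 3 * s ^ 3)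
      (L / 2 * t ^ 2 * ‖d‖ ^ 3) t := by
    refine ((hasDerivAt_pow 3 t).const_mul (L / 6 * ‖d‖ ^ 3)).congr_deriv ?_
    push_cast
    ring
  have h := image_norm_le_of_norm_deriv_right_le_deriv_boundary (a := 0) (b := 1)
    (fun t _ => (hderiv t).continuousAt.continuousWithinAt)
    (fun t _ => (hderiv t).hasDerivWithinAt) (by simp) hB
    (fun t ht => by
      refine (norm_inner_le_norm _ _).trans ?_
      refine (mul_le_mul_of_nonneg_right
        (norm_sub_sub_fderiv_le (differentiable_gradient hf) hL x (t • d))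
        (norm_nonneg d)).trans_eq ?_
      rw [norm_smul, Real.norm_of_nonneg ht.1]
      ring)
    (Set.right_mem_Icc.2 zero_le_one)
  simpa using h

theorem inner_gradient_sub_ge_of_strongConvex {ρ : E → ℝ} {σ : ℝ}
    (hsc : ∀ x y, ρ y ≥ ρ x + ⟪gradient ρ x, y - x⟫ + σ / 2 * ‖y - x‖ ^ 2) (x d : E) :
    σ * ‖d‖ ^ 2 ≤ ⟪gradient ρ (x + d) - gradient ρ x, d⟫ := by
  have h₁ := hsc x (x + d)
  have h₂ := hsc (x + d) x
  rw [add_sub_cancel_left] at h₁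
  rw [sub_add_cancel_left, inner_neg_right, norm_neg] at h₂
  rw [inner_sub_left]
  linarith

end Taylor

theorem mul_div_add_sqrt_le {a b ξ r : ℝ} (ha : 0 ≤ a) (hb : 0 < b) (hξ : 0 < ξ)
    (hr : r = ξ / (a + √(ξ * b))) : a * r + b * r ^ 2 ≤ ξ := by
  have hs : 0 < √(ξ * b) := Real.sqrt_pos.2 (mul_pos hξ hb)
  have hs2 : √(ξ * b) ^ 2 = ξ * b := Real.sq_sqrt (mul_pos hξ hb).le
  generalize √(ξ * b) = s at *
  have hr0 : 0 < r := hr ▸ div_pos hξ (by linarith)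
  have hrs : r * (a + s) = ξ := by rw [hr]; exact div_mul_cancel₀ _ (by linarith)
  have hsr : s * r ≤ ξ := by nlinarith
  have hbr : ξ * (b * r ^ 2) ≤ ξ * (s * r) := by
    calc ξ * (b * r ^ 2) = (s * r) * (s * r) := by rw [← mul_assoc, ← hs2]; ring
      _ ≤ ξ * (s * r) := by gcongr
  linarith [le_of_mul_le_mul_left hbr hξ]

/-- Main per-iteration guarantee of the HAT method: with the prescribed choice of `r_k`
and `A_k`, the KKT point of the trust-region subproblem yields either sufficient decrease
in function value, or contraction of the gradient norm by factor `ξ`. -/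
theorem stmt5 {n : ℕ} (f ρ : EuclideanSpace ℝ (Fin n) → ℝ) (L₂ σV LV η ξ : ℝ)
    (hf : ContDiff ℝ 2 f)
    (hfLip : ∀ x y, ‖fderiv ℝ (gradient f) x - fderiv ℝ (gradient f) y‖ ≤ L₂ * ‖x - y‖)
    (hρ : ContDiff ℝ 2 ρ)
    (hsc : ∀ x y, ρ y ≥ ρ x + ⟪gradient ρ x, y - x⟫ + σV / 2 * ‖y - x‖ ^ 2)
    (hρlip : ∀ x y, ‖gradient ρ y - gradient ρ x‖ ≤ LV * ‖y - x‖)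
    (hσL : LV < 2 * σV)
    (hη : 0 < η) (hξ0 : 0 < ξ) (hξ1 : ξ < 1)
    (xk : EuclideanSpace ℝ (Fin n)) (hxk : gradient f xk ≠ 0)
    (Hk : EuclideanSpace ℝ (Fin n) →L[ℝ] EuclideanSpace ℝ (Fin n))
    (hHsym : ∀ u v, ⟪Hk u, v⟫ = ⟪u, Hk v⟫)
    (rk Ak : ℝ)
    (hrk : rk = ξ / (‖fderiv ℝ (gradient f) xk - Hk‖ / Real.sqrt ‖gradient f xk‖
          * (1 + LV / (2 * σV - LV))
        + Real.sqrt (ξ * (L₂ / 2 + LV * (2 * η + L₂ / 3) / (2 * σV - LV)))))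
    (hAk : Ak = ‖fderiv ℝ (gradient f) xk - Hk‖ / (2 * σV - LV)
        + rk * Real.sqrt ‖gradient f xk‖ / (2 * σV - LV) * (2 * η + L₂ / 3))
    (d : EuclideanSpace ℝ (Fin n)) (lam : ℝ) (hlam : 0 ≤ lam)
    (hKKT1 : Hk d + lam • d + Ak • (gradient ρ (xk + d) - gradient ρ xk) = -gradient f xk)
    (hKKT2 : ∀ v, 0 ≤ ⟪Hk v + Ak • (fderiv ℝ (gradient ρ) (xk + d)) v + lam • v, v⟫)
    (hKKT3 : ‖d‖ ≤ rk * Real.sqrt ‖gradient f xk‖)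
    (hKKT4 : lam * (‖d‖ - rk * Real.sqrt ‖gradient f xk‖) = 0) :
    f (xk + d) - f xk ≤ -η * rk ^ 3 * ‖gradient f xk‖ ^ ((3 : ℝ) / 2) ∨
      ‖gradient f (xk + d)‖ ≤ ξ * ‖gradient f xk‖ := by
  set G := ‖gradient f xk‖ with hGdef
  set e := ‖fderiv ℝ (gradient f) xk - Hk‖ with hedef
  have he : 0 ≤ e := norm_nonneg _
  have hG : 0 < G := norm_pos_iff.2 hxk
  have hL₂ : 0 ≤ L₂ := by
    have h := (norm_nonneg _).trans (hfLip (gradient f xk) 0)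
    rw [sub_zero] at h
    exact nonneg_of_mul_nonneg_left h hG
  have hmono := inner_gradient_sub_ge_of_strongConvex hsc
  have hσLV : σV ≤ LV := by
    have h := (hmono 0 (gradient f xk)).trans (real_inner_le_norm _ _)
    have h' := hρlip 0 (0 + gradient f xk)
    rw [add_sub_cancel_left] at h'
    have := h.trans (mul_le_mul_of_nonneg_right h' hG.le)
    exact le_of_mul_le_mul_right (by linarith) (pow_pos hG 2)
  have hLV : 0 < LV := by linarith
  set δ := 2 * σV - LV with hδdef
  have hδ : 0 < δ := by linarith
  set S := √G with hSdef
  have hS : 0 < S := Real.sqrt_pos.2 hG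
  have hS2 : S ^ 2 = G := Real.sq_sqrt hG.le
  set b := L₂ / 2 + LV * (2 * η + L₂ / 3) / δ with hbdef
  have hb : 0 < b := by positivity
  have ha : 0 ≤ e / S * (1 + LV / δ) := by positivity
  have hr : 0 ≤ rk := by rw [hrk]; positivity
  have hA : 0 ≤ Ak := by rw [hAk]; positivity
  set R := rk * S with hRdef
  have hR : 0 ≤ R := by positivity
  have hEd : ‖(fderiv ℝ (gradient f) xk - Hk) d‖ ≤ e * ‖d‖ := ContinuousLinearMap.le_opNorm _ _
  have hAδ : Ak * δ = e + R * (2 * η + L₂ / 3) := by rw [hAk]; field_simp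
  rcases eq_or_ne lam 0 with hlam0 | hlam0
  · right
    have hT := norm_sub_sub_fderiv_le (differentiable_gradient hf) hfLip xk d
    have hV := hρlip xk (xk + d)
    rw [add_sub_cancel_left] at hV
    have hsplit : gradient f (xk + d)
        = (gradient f (xk + d) - gradient f xk - fderiv ℝ (gradient f) xk d)
          + (fderiv ℝ (gradient f) xk - Hk) d
          - Ak • (gradient ρ (xk + d) - gradient ρ xk) := by
      rw [← neg_eq_iff_eq_neg.2 hKKT1, hlam0, sub_apply]
      module
    calc ‖gradient f (xk + d)‖
        ≤ L₂ / 2 * ‖d‖ ^ 2 + e * ‖d‖ + Ak * (LV * ‖d‖) := by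
          rw [hsplit]
          refine (norm_sub_le _ _).trans (add_le_add ((norm_add_le _ _).trans
            (add_le_add hT hEd)) ?_)
          rw [norm_smul, Real.norm_of_nonneg hA]
          gcongr
      _ ≤ L₂ / 2 * R ^ 2 + e * R + Ak * (LV * R) := by gcongr
      _ = (e / S * (1 + LV / δ) * rk + b * rk ^ 2) * G := by
          rw [hAk, hbdef, ← hS2, hRdef]
          field_simp
          ring
      _ ≤ ξ * G := by gcongr; exact mul_div_add_sqrt_le ha hb hξ0 hrk
  · left
    have hd : ‖d‖ = R := sub_eq_zero.1 ((mul_eq_zero.1 hKKT4).resolve_left hlam0)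
    have hT := (abs_le.1 (abs_sub_quadratic_model_le hf hfLip xk d)).2
    have h₁ := congrArg (fun v => ⟪v, d⟫) hKKT1
    have h₂ := hKKT2 d
    simp only [inner_add_left, real_inner_smul_left, inner_neg_left,
      real_inner_self_eq_norm_sq] at h₁ h₂
    have hE : ⟪fderiv ℝ (gradient f) xk d, d⟫ - ⟪Hk d, d⟫ ≤ e * ‖d‖ ^ 2 := by
      rw [← inner_sub_left, ← sub_apply]
      calc _ ≤ _ := real_inner_le_norm _ _
        _ ≤ e * ‖d‖ * ‖d‖ := by gcongr
        _ = e * ‖d‖ ^ 2 := by ring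
    have hV₁ := mul_le_mul_of_nonneg_left (hmono xk d) hA
    have hV₂ := mul_le_mul_of_nonneg_left
      (inner_fderiv_le_of_lipschitz hLV.le hρlip (xk + d) d) hA
    have hpow : rk ^ 3 * G ^ ((3 : ℝ) / 2) = R ^ 3 := by
      rw [hRdef, mul_pow, hSdef, Real.sqrt_eq_rpow, ← Real.rpow_mul_natCast hG.le]
      norm_num
    have hAR : Ak * δ * R ^ 2 = e * R ^ 2 + R ^ 3 * (2 * η + L₂ / 3) := by rw [hAδ]; ring
    rw [hδdef] at hAR
    rw [mul_assoc, hpow]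
    rw [hd] at *
    have hlamR : 0 ≤ lam * R ^ 2 := by positivity
    linarith
end

section
/- Let N ≥ 1, c ≥ 1, and for i = 1, …, N let φᵢ : ℝⁿ → ℝᶜ have twice continuously differentiable components with ‖∇²(φᵢ)ⱼ(x)‖ ≤ L for all x ∈ ℝⁿ and all j ∈ {1, …, c}, and let bᵢ ∈ {1, …, c}. For x ∈ ℝⁿ let pᵢ(x) ∈ ℝᶜ be the softmax vector pᵢ(x)ⱼ = exp((φᵢ(x))ⱼ)/Σ_{k=1}^{c} exp((φᵢ(x))ₖ). Define f(x) = −Σᵢ₌₁ᴺ log pᵢ(x)_{bᵢ} and H(x) = Σᵢ₌₁ᴺ Jᵢ(x)ᵀ·(diag(pᵢ(x)) − pᵢ(x)pᵢ(x)ᵀ)·Jᵢ(x), where Jᵢ(x) ∈ ℝ^{c×n} is the Jacobian of φᵢ at x. Suppose f is star-convex with respect to a global minimizer x_*: f(x_*) ≥ f(x) + ⟨∇f(x), x_* − x⟩ for all x ∈ ℝⁿ. Then for every x ∈ ℝⁿ, ‖∇²f(x) − H(x)‖ ≤ 2L·‖∇f(x)‖·‖x − x_*‖ + 2L·f(x_*).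 -/
open RealInnerProductSpace

section Softmax

variable {ι E : Type*} [Fintype ι]

theorem sum_exp_pos [Nonempty ι] (a : ι → ℝ) : 0 < ∑ k, Real.exp (a k) :=
  Finset.sum_pos (fun _ _ => Real.exp_pos _) Finset.univ_nonempty

theorem hasFDerivAt_log_sum_exp [Nonempty ι] [NormedAddCommGroup E] [NormedSpace ℝ E]
    {φ : ι → E → ℝ} {φ' : ι → E →L[ℝ] ℝ} {x : E} (h : ∀ k, HasFDerivAt (φ k) (φ' k) x) :
    HasFDerivAt (fun y => Real.log (∑ k, Real.exp (φ k y)))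
      (∑ k, (Real.exp (φ k x) / ∑ l, Real.exp (φ l x)) • φ' k) x := by
  have hS : HasFDerivAt (fun y => ∑ k, Real.exp (φ k y)) (∑ k, Real.exp (φ k x) • φ' k) x :=
    HasFDerivAt.fun_sum fun k _ => (h k).exp
  convert hS.log (sum_exp_pos fun k => φ k x).ne' using 1
  rw [Finset.smul_sum]
  refine Finset.sum_congr rfl fun k _ => ?_
  rw [smul_smul, div_eq_inv_mul]

theorem hasFDerivAt_softmax [Nonempty ι] [NormedAddCommGroup E] [NormedSpace ℝ E]
    {φ : ι → E → ℝ} {φ' : ι → E →L[ℝ] ℝ} {x : E} (h : ∀ k, HasFDerivAt (φ k) (φ' k) x) (j : ι) :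
    HasFDerivAt (fun y => Real.exp (φ j y) / ∑ k, Real.exp (φ k y))
      ((Real.exp (φ j x) / ∑ k, Real.exp (φ k x)) •
        (φ' j - ∑ k, (Real.exp (φ k x) / ∑ l, Real.exp (φ l x)) • φ' k)) x := by
  have hexp : ∀ y, Real.exp (φ j y) / ∑ k, Real.exp (φ k y) =
      Real.exp (φ j y - Real.log (∑ k, Real.exp (φ k y))) := fun y => by
    rw [Real.exp_sub, Real.exp_log (sum_exp_pos fun k => φ k y)]
  have key := ((h j).sub (hasFDerivAt_log_sum_exp h)).exp
  rw [funext hexp, hexp x]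
  exact key

theorem neg_log_softmax [Nonempty ι] (a : ι → ℝ) (b : ι) :
    -Real.log (Real.exp (a b) / ∑ k, Real.exp (a k)) =
      Real.log (∑ k, Real.exp (a k)) - a b := by
  rw [Real.log_div (Real.exp_pos _).ne' (sum_exp_pos a).ne', Real.log_exp]
  ring

theorem norm_sum_smul_sub_le [NormedAddCommGroup E] [NormedSpace ℝ E] {p : ι → ℝ} {D : ι → E}
    {L : ℝ} (b : ι) (hp : ∀ j, 0 ≤ p j) (hsum : ∑ j, p j = 1) (hD : ∀ j, ‖D j‖ ≤ L) :
    ‖∑ j, p j • D j - D b‖ ≤ 2 * L * (1 - p b) := by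
  classical
  have hL : 0 ≤ L := (norm_nonneg _).trans (hD b)
  have hsub : ∑ j, p j • D j - D b = ∑ j, p j • (D j - D b) := by
    simp only [smul_sub, Finset.sum_sub_distrib, ← Finset.sum_smul, hsum, one_smul]
  have hsplit : p b + ∑ j ∈ Finset.univ.erase b, p j = 1 := by
    rw [Finset.add_sum_erase _ _ (Finset.mem_univ b), hsum]
  rw [hsub, ← Finset.add_sum_erase _ _ (Finset.mem_univ b), sub_self, smul_zero, zero_add,
    ← hsplit, add_sub_cancel_left, Finset.mul_sum]
  refine norm_sum_le_of_le _ fun j _ => ?_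
  rw [norm_smul, Real.norm_of_nonneg (hp j), mul_comm]
  refine mul_le_mul_of_nonneg_right ?_ (hp j)
  linarith [norm_sub_le (D j) (D b), hD j, hD b]

end Softmax

theorem ContDiff.differentiable_gradient {E : Type*} [NormedAddCommGroup E]
    [InnerProductSpace ℝ E] [CompleteSpace E] {g : E → ℝ} (hg : ContDiff ℝ 2 g) :
    Differentiable ℝ (gradient g) :=
  (InnerProductSpace.toDual ℝ E).symm.differentiable.comp
    ((hg.fderiv_right (m := 1) (by norm_num)).differentiable (by norm_num))

/-- Generalized Gauss–Newton approximation error for the softmax cross-entropy objective: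
under star-convexity:
`‖∇²f(x) − H(x)‖ ≤ 2L‖∇f(x)‖‖x − x_*‖ + 2L f(x_*)`. Here `φ i j` is the `j`-th component of the `c`-valued model
`φᵢ : ℝⁿ → ℝᶜ`, `p i x j` is the softmax probability, and `H x` is the action of
`Σᵢ Jᵢ(x)ᵀ(diag(pᵢ(x)) − pᵢ(x)pᵢ(x)ᵀ)Jᵢ(x)`. -/
theorem stmt18 {n : ℕ} (N c : ℕ) (hN : 1 ≤ N) (hc : 1 ≤ c) (L : ℝ)
    (φ : Fin N → Fin c → EuclideanSpace ℝ (Fin n) → ℝ) (b : Fin N → Fin c)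
    (hφ : ∀ i j, ContDiff ℝ 2 (φ i j))
    (hHessφ : ∀ i j x, ‖fderiv ℝ (gradient (φ i j)) x‖ ≤ L)
    (p : Fin N → EuclideanSpace ℝ (Fin n) → Fin c → ℝ)
    (hp : ∀ i x j, p i x j = Real.exp (φ i j x) / ∑ k, Real.exp (φ i k x))
    (f : EuclideanSpace ℝ (Fin n) → ℝ)
    (hfdef : ∀ x, f x = -∑ i, Real.log (p i x (b i)))
    (H : EuclideanSpace ℝ (Fin n) →
      EuclideanSpace ℝ (Fin n) →L[ℝ] EuclideanSpace ℝ (Fin n))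
    (hHdef : ∀ x v, H x v = ∑ i, ∑ j,
      (p i x j * ⟪gradient (φ i j) x, v⟫
        - p i x j * ∑ k, p i x k * ⟪gradient (φ i k) x, v⟫) • gradient (φ i j) x)
    (xstar : EuclideanSpace ℝ (Fin n)) (hmin : ∀ y, f xstar ≤ f y)
    (hstar : ∀ x, f xstar ≥ f x + ⟪gradient f x, xstar - x⟫) :
    ∀ x, ‖fderiv ℝ (gradient f) x - H x‖
      ≤ 2 * L * ‖gradient f x‖ * ‖x - xstar‖ + 2 * L * f xstar := by
  have : Nonempty (Fin c) := ⟨⟨0, hc⟩⟩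
  have hL : 0 ≤ L := (norm_nonneg _).trans (hHessφ ⟨0, hN⟩ ⟨0, hc⟩ xstar)
  have hpos : ∀ i x j, 0 < p i x j := fun i x j => by
    rw [hp]; exact div_pos (Real.exp_pos _) (sum_exp_pos _)
  have hsum : ∀ i x, ∑ j, p i x j = 1 := fun i x => by
    simp only [hp, ← Finset.sum_div]; exact div_self (sum_exp_pos _).ne'
  have hdφ : ∀ i j x, HasFDerivAt (φ i j)
      (InnerProductSpace.toDual ℝ _ (gradient (φ i j) x)) x := fun i j x =>
    (((hφ i j).differentiable (by norm_num)) x).hasGradientAt.hasFDerivAt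
  have hfsum : f = fun x => ∑ i, (Real.log (∑ k, Real.exp (φ i k x)) - φ i (b i) x) := by
    funext x
    rw [hfdef, ← Finset.sum_neg_distrib]
    refine Finset.sum_congr rfl fun i _ => ?_
    rw [hp, neg_log_softmax (fun k => φ i k x)]
  have hgrad : gradient f = fun x =>
      ∑ i, (∑ j, p i x j • gradient (φ i j) x - gradient (φ i (b i)) x) := by
    funext x
    refine HasGradientAt.gradient (hasGradientAt_iff_hasFDerivAt.2 ?_)
    rw [hfsum]
    simp only [map_sum, map_sub, map_smul, hp]
    exact HasFDerivAt.fun_sum fun i _ =>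
      (hasFDerivAt_log_sum_exp fun k => hdφ i k x).sub (hdφ i (b i) x)
  intro x
  have hdp : ∀ i j, HasFDerivAt (fun y => p i y j)
      (p i x j • (InnerProductSpace.toDual ℝ _ (gradient (φ i j) x) -
        ∑ k, p i x k • InnerProductSpace.toDual ℝ _ (gradient (φ i k) x))) x := fun i j => by
    simp only [hp]
    exact hasFDerivAt_softmax (fun k => hdφ i k x) j
  have hdg : ∀ i j, HasFDerivAt (gradient (φ i j)) (fderiv ℝ (gradient (φ i j)) x) x :=
    fun i j => ((hφ i j).differentiable_gradient x).hasFDerivAt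
  have hHess := HasFDerivAt.fun_sum (u := Finset.univ) fun (i : Fin N) _ =>
    (HasFDerivAt.fun_sum (u := Finset.univ) fun j _ => (hdp i j).smul (hdg i j)).sub
      (hdg i (b i))
  have hdiff : fderiv ℝ (gradient f) x - H x =
      ∑ i, (∑ j, p i x j • fderiv ℝ (gradient (φ i j)) x
        - fderiv ℝ (gradient (φ i (b i))) x) := by
    rw [hgrad]
    refine (congrArg (· - H x) hHess.fderiv).trans ?_
    ext1 v
    simp only [sub_apply, sum_apply, hHdef,
      add_apply, smul_apply,
      ContinuousLinearMap.smulRight_apply, InnerProductSpace.toDual_apply_apply,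
      Finset.sum_add_distrib, Finset.sum_sub_distrib, smul_eq_mul, mul_sub]
    abel
  have hbound : ‖fderiv ℝ (gradient f) x - H x‖ ≤ 2 * L * f x := by
    rw [hdiff, hfdef, ← Finset.sum_neg_distrib, Finset.mul_sum]
    refine norm_sum_le_of_le _ fun i _ => (norm_sum_smul_sub_le (b i)
      (fun j => (hpos i x j).le) (hsum i x) fun j => hHessφ i j x).trans ?_
    refine mul_le_mul_of_nonneg_left ?_ (by positivity)
    linarith [Real.log_le_sub_one_of_pos (hpos i x (b i))]
  have hfx : f x ≤ ‖gradient f x‖ * ‖x - xstar‖ + f xstar := by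
    have hcs := real_inner_le_norm (gradient f x) (x - xstar)
    have hneg : ⟪gradient f x, xstar - x⟫ = -⟪gradient f x, x - xstar⟫ := by
      rw [← inner_neg_right, neg_sub]
    have := hstar x
    linarith
  calc _ ≤ 2 * L * f x := hbound
    _ ≤ 2 * L * (‖gradient f x‖ * ‖x - xstar‖ + f xstar) :=
      mul_le_mul_of_nonneg_left hfx (by positivity)
    _ = _ := by ring
end
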